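/- Let n ≥ 1 and let A = (a_ij) be a positive n×n matrix. For every positive vector x = (x_j) in ℝⁿ, every k ≥ 1 and every sequence of indices i_0, i_1, …, i_{k−1} in {1, …, n}, the geometric cycle mean satisfies (∏_{t=0}^{k−1} a_{i_t i_{(t+1) mod k}})^{1/k} ≤ max_{1≤i,j≤n} a_ij x_j / x_i. -/

import Mathlib

/-- For a positive matrix `A` and positive vector `x`, the geometric cycle mean of
any cycle of length `k ≥ 1` is bounded above by the log-Chebyshev objective
`max_{i,j} a i j * x j / x i`. -/
theorem cycle_mean_le_logChebyshev_objective
    (n : ℕ) (hn : 1 ≤ n) (A : Matrix (Fin n) (Fin n) ℝ)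
    (hpos : ∀ i j, 0 < A i j)
    (x : Fin n → ℝ) (hx : ∀ j, 0 < x j)
    (k : ℕ) (hk : 1 ≤ k) (c : Fin k → Fin n) :
    (∏ t : Fin k, A (c t) (c ⟨(t.1 + 1) % k, Nat.mod_lt _ hk⟩)) ^ ((k : ℝ)⁻¹) ≤
      ⨆ i, ⨆ j, A i j * x j / x i := by
  obtain ⟨m, rfl⟩ : ∃ m, k = m + 1 := ⟨k - 1, by omega⟩
  set M := ⨆ i, ⨆ j, A i j * x j / x i with hM
  have hle : ∀ i j, A i j * x j / x i ≤ M := by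
    intro i j
    have h1 : A i j * x j / x i ≤ ⨆ j, A i j * x j / x i :=
      le_ciSup (f := fun j => A i j * x j / x i) (Set.finite_range _).bddAbove j
    have h2 : (⨆ j, A i j * x j / x i) ≤ M :=
      le_ciSup (f := fun i => ⨆ j, A i j * x j / x i) (Set.finite_range _).bddAbove i
    exact h1.trans h2
  have hnn : ∀ i j, 0 ≤ A i j * x j / x i := fun i j =>
    (div_pos (mul_pos (hpos i j) (hx j)) (hx i)).le
  have hM0 : 0 ≤ M := (hnn (c 0) (c 0)).trans (hle _ _)
  have hs : ∀ t : Fin (m + 1),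
      (⟨(t.1 + 1) % (m + 1), Nat.mod_lt _ hk⟩ : Fin (m + 1)) = t + 1 := by
    intro t
    apply Fin.ext
    simp [Fin.val_add]
  simp only [hs]
  have hprod : ∏ t : Fin (m + 1), x (c (t + 1)) = ∏ t : Fin (m + 1), x (c t) :=
    Equiv.prod_comp (Equiv.addRight (1 : Fin (m + 1))) (fun t => x (c t))
  have hne : ∏ t : Fin (m + 1), x (c t) ≠ 0 :=
    Finset.prod_ne_zero_iff.mpr fun t _ => (hx _).ne'
  have heq : ∏ t : Fin (m + 1), A (c t) (c (t + 1))
      = ∏ t : Fin (m + 1), (A (c t) (c (t + 1)) * x (c (t + 1)) / x (c t)) := by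
    rw [Finset.prod_div_distrib, Finset.prod_mul_distrib, hprod, mul_div_assoc, div_self hne,
      mul_one]
  have hb : ∏ t : Fin (m + 1), A (c t) (c (t + 1)) ≤ M ^ (m + 1) := by
    rw [heq]
    calc _ ≤ ∏ _t : Fin (m + 1), M :=
          Finset.prod_le_prod (fun t _ => hnn _ _) (fun t _ => hle _ _)
      _ = M ^ (m + 1) := by simp
  have h0 : 0 ≤ ∏ t : Fin (m + 1), A (c t) (c (t + 1)) :=
    Finset.prod_nonneg fun t _ => (hpos _ _).le
  calc _ ≤ (M ^ (m + 1)) ^ (((m + 1 : ℕ) : ℝ)⁻¹) :=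
        Real.rpow_le_rpow h0 hb (by positivity)
    _ = M := Real.pow_rpow_inv_natCast hM0 (by omega)
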